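/- For every 3-CNF formula φ with m variables and s ≥ 1 clauses, there exist a natural number N with N ≤ 2s + 9s², and a family of N uncertain segments, i.e., endpoint functions a, b, a', b' : Fin N → ℝ with 0 ≤ a i ≤ b i ≤ 1 and 0 ≤ a' i ≤ b' i ≤ 1 for all i, such that φ is satisfiable if and only if there exists a choice c : Fin N → Bool with [0,1] ⊆ ⋃_{i} J_i, where J_i = [a i, b i] if c i = true and J_i = [a' i, b' i] if c i = false. -/

import Mathlib

namespace SegCover

/-- Literal occurrences: clause index and position in the clause. -/
abbrev Lit (s : ℕ) := Fin s × Fin 3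

/-- Position of a literal occurrence in `[0, 3s)`. -/
def pos {s : ℕ} (p : Lit s) : ℕ := 3 * p.1 + p.2

/-- Integer interval `[lo, hi)` of unit cells. -/
def Mem (n : ℕ) (I : ℕ × ℕ) : Prop := I.1 ≤ n ∧ n < I.2

def cellIdx {s : ℕ} (p q : Lit s) : ℕ := pos p * (3 * s) + pos q

def reg {s : ℕ} (p : Lit s) : ℕ × ℕ := (pos p * (3 * s), (pos p + 1) * (3 * s))

def cel {s : ℕ} (p q : Lit s) : ℕ × ℕ := (cellIdx p q, cellIdx p q + 1)

def Conf {m s : ℕ} (cl : Fin s → Fin 3 → Fin m × Bool) (p q : Lit s) : Prop :=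
  (cl p.1 p.2).1 = (cl q.1 q.2).1 ∧ (cl p.1 p.2).2 ≠ (cl q.1 q.2).2

instance {m s : ℕ} (cl : Fin s → Fin 3 → Fin m × Bool) (p q : Lit s) :
    Decidable (Conf cl p q) := by unfold Conf; infer_instance

/-- Index type of the uncertain segments: two per clause, one per ordered pair of literals. -/
abbrev Idx (s : ℕ) := (Fin s × Bool) ⊕ (Lit s × Lit s)

/-- The two options (`true` / `false`) of each uncertain segment. -/
def opt {m s : ℕ} (cl : Fin s → Fin 3 → Fin m × Bool) : Bool → Idx s → ℕ × ℕ
  | true, .inl (i, true) => reg (i, 0)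
  | false, .inl (i, true) => reg (i, 1)
  | true, .inl (i, false) => reg (i, 1)
  | false, .inl (i, false) => reg (i, 2)
  | t, .inr (p, q) =>
      if Conf cl p q then
        if pos p < pos q then (if t then cel p q else cel q p) else (0, 0)
      else cel p q

lemma pos_lt {s : ℕ} (p : Lit s) : pos p < 3 * s := by
  unfold pos; have := p.1.2; have := p.2.2; omega

lemma pos_inj {s : ℕ} {p q : Lit s} (h : pos p = pos q) : p = q := by
  unfold pos at h
  have := p.2.2; have := q.2.2
  ext <;> omega

lemma pos_surj {s n : ℕ} (h : n < 3 * s) : ∃ p : Lit s, pos p = n :=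
  ⟨(⟨n / 3, by omega⟩, ⟨n % 3, by omega⟩), by simp only [pos]; omega⟩

lemma cellIdx_div {s : ℕ} (p q : Lit s) : cellIdx p q / (3 * s) = pos p := by
  unfold cellIdx
  have := pos_lt q
  rw [mul_comm, Nat.mul_add_div (by omega), Nat.div_eq_of_lt this, add_zero]

lemma cellIdx_mod {s : ℕ} (p q : Lit s) : cellIdx p q % (3 * s) = pos q := by
  unfold cellIdx
  rw [mul_comm, Nat.mul_add_mod, Nat.mod_eq_of_lt (pos_lt q)]

lemma cellIdx_lt {s : ℕ} (p q : Lit s) : cellIdx p q < (3 * s) * (3 * s) := by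
  have h1 := pos_lt p
  have h2 := pos_lt q
  unfold cellIdx
  nlinarith

lemma cellIdx_surj {s n : ℕ} (h : n < (3 * s) * (3 * s)) :
    ∃ p q : Lit s, cellIdx p q = n := by
  have hs : 0 < 3 * s := by
    rcases Nat.eq_zero_or_pos (3 * s) with h0 | h0
    · rw [h0] at h; omega
    · exact h0
  obtain ⟨p, hp⟩ := pos_surj (Nat.div_lt_of_lt_mul h)
  obtain ⟨q, hq⟩ := pos_surj (Nat.mod_lt n hs)
  refine ⟨p, q, ?_⟩
  unfold cellIdx
  rw [hp, hq, mul_comm, Nat.div_add_mod]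

lemma mem_reg {s : ℕ} (p q r : Lit s) : Mem (cellIdx p q) (reg r) ↔ p = r := by
  have h0 := pos_lt q
  have hs : 0 < 3 * s := by omega
  constructor
  · rintro ⟨h1, h2⟩
    apply pos_inj
    rw [← cellIdx_div p q]
    exact Nat.div_eq_of_lt_le h1 h2
  · rintro rfl
    unfold Mem reg cellIdx
    constructor
    · simp
    · simp only [add_mul]; omega

lemma mem_cel {s : ℕ} (p q r t : Lit s) :
    Mem (cellIdx p q) (cel r t) ↔ p = r ∧ q = t := by
  constructor
  · rintro ⟨h1, h2⟩
    have h : cellIdx p q = cellIdx r t := by simp only [cel] at h1 h2; omega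
    exact ⟨pos_inj (by rw [← cellIdx_div p q, h, cellIdx_div]),
      pos_inj (by rw [← cellIdx_mod p q, h, cellIdx_mod])⟩
  · rintro ⟨rfl, rfl⟩
    simp [Mem, cel]

lemma opt_bd {m s : ℕ} (cl : Fin s → Fin 3 → Fin m × Bool) (t : Bool) (i : Idx s) :
    (opt cl t i).1 ≤ (opt cl t i).2 ∧ (opt cl t i).2 ≤ (3 * s) * (3 * s) := by
  have hr : ∀ p : Lit s, (reg p).1 ≤ (reg p).2 ∧ (reg p).2 ≤ (3 * s) * (3 * s) := fun p =>
    ⟨Nat.mul_le_mul_right _ (by omega), Nat.mul_le_mul_right _ (pos_lt p)⟩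
  have hc : ∀ p q : Lit s, (cel p q).1 ≤ (cel p q).2 ∧ (cel p q).2 ≤ (3 * s) * (3 * s) :=
    fun p q => ⟨by simp [cel], cellIdx_lt p q⟩
  rcases i with ⟨i, b⟩ | ⟨p, q⟩
  · cases t <;> cases b <;> exact hr _
  · have : opt cl t (.inr (p, q)) = if Conf cl p q then
        if pos p < pos q then (if t then cel p q else cel q p) else (0, 0)
      else cel p q := by cases t <;> rfl
    rw [this]
    split_ifs
    · exact hc _ _
    · exact hc _ _
    · simp
    · exact hc _ _

lemma opt_inr {m s : ℕ} (cl : Fin s → Fin 3 → Fin m × Bool) (t : Bool) (p q : Lit s) :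
    opt cl t (.inr (p, q)) = if Conf cl p q then
        if pos p < pos q then (if t then cel p q else cel q p) else (0, 0)
      else cel p q := by cases t <;> rfl

lemma Conf.symm {m s : ℕ} {cl : Fin s → Fin 3 → Fin m × Bool} {p q : Lit s}
    (h : Conf cl p q) : Conf cl q p := ⟨h.1.symm, h.2.symm⟩

/-- Which literal is left over in clause `i` by the two clause segments. -/
lemma left_over {m s : ℕ} (cl : Fin s → Fin 3 → Fin m × Bool) (c : Idx s → Bool) (i : Fin s) :
    ∃ k : Fin 3, ∀ (q : Lit s) (j : Fin s × Bool),
      ¬ Mem (cellIdx (i, k) q) (opt cl (c (.inl j)) (.inl j)) := by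
  refine ⟨if c (.inl (i, true)) then (if c (.inl (i, false)) then 2 else 1) else
    (if c (.inl (i, false)) then 0 else 0), ?_⟩
  rintro q ⟨j, b⟩ h
  by_cases hj : j = i
  · subst hj
    cases b <;> cases h1 : c (.inl (j, true)) <;> cases h2 : c (.inl (j, false)) <;>
      simp [h1, h2, opt, mem_reg] at h
  · have : i = j := by
      cases b <;> cases h1 : c (.inl (j, true)) <;> cases h2 : c (.inl (j, false)) <;>
        simp only [h1, h2, opt, mem_reg, Prod.mk.injEq] at h <;> exact h.1
    exact hj this.symm

lemma discrete {m s : ℕ} (cl : Fin s → Fin 3 → Fin m × Bool) :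
    (∃ σ : Fin m → Bool, ∀ i, ∃ k, σ (cl i k).1 = (cl i k).2) ↔
    ∃ c : Idx s → Bool, ∀ p q : Lit s, ∃ i, Mem (cellIdx p q) (opt cl (c i) i) := by
  constructor
  · rintro ⟨σ, h⟩
    choose k hk using h
    let c : Idx s → Bool := fun x => match x with
      | .inl (i, true) => decide (k i ≠ 0)
      | .inl (i, false) => decide (k i = 2)
      | .inr (p, _) => decide (σ (cl p.1 p.2).1 = (cl p.1 p.2).2)
    refine ⟨c, ?_⟩
    rintro ⟨i, l⟩ q
    by_cases hl : l = k i
    · subst hl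
      by_cases hc : Conf cl (i, k i) q
      · rcases lt_trichotomy (pos (i, k i)) (pos q) with hlt | heq | hgt
        · refine ⟨.inr ((i, k i), q), ?_⟩
          rw [opt_inr, if_pos hc, if_pos hlt, if_pos (by simp [c, hk]), mem_cel]
          exact ⟨rfl, rfl⟩
        · have := pos_inj heq
          subst this
          exact absurd rfl hc.2
        · refine ⟨.inr (q, (i, k i)), ?_⟩
          have hf : ¬ (c (.inr (q, (i, k i))) = true) := by
            simp only [c, decide_eq_true_eq]
            intro h
            apply hc.2
            rw [← h, ← hc.1]
            exact (hk i).symm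
          rw [opt_inr, if_pos hc.symm, if_pos hgt, if_neg hf, mem_cel]
          exact ⟨rfl, rfl⟩
      · refine ⟨.inr ((i, k i), q), ?_⟩
        rw [opt_inr, if_neg hc, mem_cel]
        exact ⟨rfl, rfl⟩
    · have key : ∃ b, opt cl (c (.inl (i, b))) (.inl (i, b)) = reg (i, l) := by
        have hh : ∀ x l : Fin 3, l ≠ x →
            (l = 0 ∧ x ≠ 0) ∨ (l = 1 ∧ x = 0) ∨ (l = 1 ∧ x = 2) ∨ (l = 2 ∧ x ≠ 2) := by decide
        rcases hh _ _ hl with ⟨rfl, h⟩ | ⟨rfl, h⟩ | ⟨rfl, h⟩ | ⟨rfl, h⟩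
        · exact ⟨true, by simp [c, h, opt]⟩
        · exact ⟨true, by simp [c, h, opt]⟩
        · exact ⟨false, by simp [c, h, opt]⟩
        · exact ⟨false, by simp [c, h, opt]⟩
      obtain ⟨b, hb⟩ := key
      exact ⟨.inl (i, b), by rw [hb, mem_reg]⟩
  · rintro ⟨c, h⟩
    choose k hk using left_over cl c
    have h1 : ∀ i q, Conf cl (i, k i) q →
        (pos (i, k i) < pos q ∧ c (.inr ((i, k i), q)) = true) ∨
        (pos q < pos (i, k i) ∧ c (.inr (q, (i, k i))) = false) := by
      intro i q hc
      obtain ⟨j | ⟨r, t⟩, hj⟩ := h (i, k i) q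
      · exact absurd hj (hk i q j)
      · rw [opt_inr] at hj
        split_ifs at hj with h1 h2 h3
        · rw [mem_cel] at hj
          obtain ⟨rfl, rfl⟩ := hj
          exact .inl ⟨h2, h3⟩
        · rw [mem_cel] at hj
          obtain ⟨rfl, rfl⟩ := hj
          exact .inr ⟨h2, by simpa using h3⟩
        · exact absurd hj.2 (by simp)
        · rw [mem_cel] at hj
          obtain ⟨rfl, rfl⟩ := hj
          exact absurd hc h1
    have h2 : ∀ i j, ¬ Conf cl (i, k i) (j, k j) := by
      intro i j hc
      rcases h1 i _ hc with ⟨a1, a2⟩ | ⟨a1, a2⟩ <;>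
      rcases h1 j _ hc.symm with ⟨b1, b2⟩ | ⟨b1, b2⟩
      · omega
      · rw [a2] at b2; cases b2
      · rw [a2] at b2; cases b2
      · omega
    classical
    refine ⟨fun v => decide (∃ i, cl i (k i) = (v, true)), fun i => ⟨k i, ?_⟩⟩
    cases ht : (cl i (k i)).2
    · simp only [decide_eq_false_iff_not]
      rintro ⟨j, hj⟩
      exact h2 i j ⟨by simp [hj], by simp [hj, ht]⟩
    · simp only [decide_eq_true_eq]
      exact ⟨i, Prod.ext rfl ht⟩

/-- Covering `[0,1]` by grid intervals is the same as covering all unit cells. -/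
lemma cover_iff {ι : Type*} (M : ℕ) (hM : 0 < M) (I : ι → ℕ × ℕ) :
    Set.Icc (0:ℝ) 1 ⊆ (⋃ i, Set.Icc (((I i).1 : ℝ) / M) (((I i).2 : ℝ) / M)) ↔
    ∀ n < M, ∃ i, Mem n (I i) := by
  have hM' : (0:ℝ) < M := by exact_mod_cast hM
  constructor
  · intro h n hn
    have hn' : (n:ℝ) + 1 ≤ M := by exact_mod_cast hn
    have hx : ((n:ℝ) + 1/2) / M ∈ Set.Icc (0:ℝ) 1 := by
      refine ⟨by positivity, ?_⟩
      rw [div_le_one hM']; linarith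
    obtain ⟨i, h1, h2⟩ := Set.mem_iUnion.1 (h hx)
    rw [div_le_div_iff_of_pos_right hM'] at h1 h2
    refine ⟨i, ?_, ?_⟩
    · have : ((I i).1 : ℝ) < (n + 1 : ℕ) := by push_cast; linarith
      have := Nat.cast_lt.1 this
      omega
    · have : (n : ℝ) < ((I i).2 : ℝ) := by linarith
      exact Nat.cast_lt.1 this
  · rintro h x ⟨hx0, hx1⟩
    have key : ∃ n < M, (n:ℝ) ≤ x * M ∧ x * M ≤ n + 1 := by
      rcases hx1.lt_or_eq with hx | rfl
      · have h0 : 0 ≤ x * M := by positivity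
        refine ⟨⌊x * M⌋₊, ?_, Nat.floor_le h0, (Nat.lt_floor_add_one _).le⟩
        rw [Nat.floor_lt h0]
        nlinarith
      · refine ⟨M - 1, by omega, ?_, ?_⟩ <;> rw [Nat.cast_sub hM] <;> push_cast <;> linarith
    obtain ⟨n, hn, h1, h2⟩ := key
    obtain ⟨i, hi1, hi2⟩ := h n hn
    have e1 : ((I i).1 : ℝ) ≤ n := by exact_mod_cast hi1
    have e2 : (n : ℝ) + 1 ≤ ((I i).2 : ℝ) := by exact_mod_cast hi2
    refine Set.mem_iUnion.2 ⟨i, ?_, ?_⟩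
    · rw [div_le_iff₀ hM']; linarith
    · rw [le_div_iff₀ hM']; linarith

end SegCover

open SegCover in
/-- The polynomial-size reduction from 3-SAT to SEGMENT COVER: every 3-CNF
formula with `s ≥ 1` clauses has an equivalent SEGMENT COVER instance with at
most `2s + 9s²` uncertain segments. -/
theorem stmt2 (m s : ℕ) (hs : 1 ≤ s) (clauses : Fin s → Fin 3 → Fin m × Bool) :
    ∃ (N : ℕ) (a b a' b' : Fin N → ℝ),
      N ≤ 2 * s + 9 * s ^ 2 ∧
      (∀ i, 0 ≤ a i ∧ a i ≤ b i ∧ b i ≤ 1) ∧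
      (∀ i, 0 ≤ a' i ∧ a' i ≤ b' i ∧ b' i ≤ 1) ∧
      ((∃ σ : Fin m → Bool, ∀ i, ∃ k, σ (clauses i k).1 = (clauses i k).2) ↔
        (∃ c : Fin N → Bool, Set.Icc (0:ℝ) 1 ⊆
          ⋃ i, if c i then Set.Icc (a i) (b i) else Set.Icc (a' i) (b' i))) := by
  let M : ℕ := (3 * s) * (3 * s)
  have hM : 0 < M := by positivity
  have hM' : (0:ℝ) < M := by exact_mod_cast hM
  let e := Fintype.equivFin (Idx s)
  have bd : ∀ t (i : Idx s), 0 ≤ ((opt clauses t i).1 : ℝ) / M ∧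
      ((opt clauses t i).1 : ℝ) / M ≤ ((opt clauses t i).2 : ℝ) / M ∧
      ((opt clauses t i).2 : ℝ) / M ≤ 1 := by
    intro t i
    obtain ⟨h1, h2⟩ := opt_bd clauses t i
    refine ⟨by positivity, ?_, ?_⟩
    · rw [div_le_div_iff_of_pos_right hM']; exact_mod_cast h1
    · rw [div_le_one hM']; exact_mod_cast h2
  refine ⟨Fintype.card (Idx s), fun i => ((opt clauses true (e.symm i)).1 : ℝ) / M,
    fun i => ((opt clauses true (e.symm i)).2 : ℝ) / M,
    fun i => ((opt clauses false (e.symm i)).1 : ℝ) / M,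
    fun i => ((opt clauses false (e.symm i)).2 : ℝ) / M, ?_, fun i => bd _ _, fun i => bd _ _, ?_⟩
  · simp only [Fintype.card_sum, Fintype.card_prod, Fintype.card_fin, Fintype.card_bool]
    apply le_of_eq; ring
  · rw [discrete]
    have hc : ∀ c : Fin (Fintype.card (Idx s)) → Bool,
        (Set.Icc (0:ℝ) 1 ⊆ ⋃ i, if c i then
          Set.Icc (((opt clauses true (e.symm i)).1 : ℝ) / M)
            (((opt clauses true (e.symm i)).2 : ℝ) / M)
          else Set.Icc (((opt clauses false (e.symm i)).1 : ℝ) / M)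
            (((opt clauses false (e.symm i)).2 : ℝ) / M)) ↔
        ∀ n < M, ∃ i, Mem n (opt clauses (c i) (e.symm i)) := by
      intro c
      rw [← cover_iff M hM (fun i => opt clauses (c i) (e.symm i))]
      have : ∀ i, (if c i then
          Set.Icc (((opt clauses true (e.symm i)).1 : ℝ) / M)
            (((opt clauses true (e.symm i)).2 : ℝ) / M)
          else Set.Icc (((opt clauses false (e.symm i)).1 : ℝ) / M)
            (((opt clauses false (e.symm i)).2 : ℝ) / M)) =
          Set.Icc (((opt clauses (c i) (e.symm i)).1 : ℝ) / M)
            (((opt clauses (c i) (e.symm i)).2 : ℝ) / M) := by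
        intro i; cases c i <;> rfl
      simp only [this]
    simp only [hc]
    constructor
    · rintro ⟨c, h⟩
      refine ⟨fun i => c (e.symm i), fun n hn => ?_⟩
      obtain ⟨p, q, rfl⟩ := cellIdx_surj hn
      obtain ⟨i, hi⟩ := h p q
      exact ⟨e i, by simpa using hi⟩
    · rintro ⟨c, h⟩
      refine ⟨fun i => c (e i), fun p q => ?_⟩
      obtain ⟨i, hi⟩ := h _ (cellIdx_lt p q)
      exact ⟨e.symm i, by simpa using hi⟩
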